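/- Let p be a prime, F = 𝔽_p, F̄ an algebraic closure of F, and G a finite group. For every simple FG-module W there exist a finite subfield K of F̄, a simple KG-module V with V | W ⊗_F K, and a finite-dimensional simple F̄G-module X such that V ⊗_K F̄ ≅ X. (This is the nonemptiness of each fiber Σ⁻¹(W) of the map Σ : ITS(F̄G) → ITS(FG), from which the formula |ITS(F̄G)| = Σ_{W ∈ ITS(FG)} |Σ⁻¹(W)| for the number of isomorphism types of absolutely simple modules follows.) -/

import Mathlib

set_option synthInstance.maxHeartbeats 1600000
set_option maxHeartbeats 1600000

open TensorProduct

/-- Base change of a representation along a (commutative) algebra `k → L`: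
the `L`-linear representation of `G` on `V ⊗_k L = L ⊗[k] V`. -/
noncomputable def repBaseChange {k : Type*} [CommRing k] (L : Type*) [CommRing L] [Algebra k L]
    {G : Type*} [Monoid G] {V : Type*} [AddCommGroup V] [Module k V]
    (ρ : Representation k G V) : Representation L G (L ⊗[k] V) :=
  (Module.End.baseChangeHom k L V).toRingHom.toMonoidHom.comp ρ

/-- Restriction of scalars `Res_K` of a representation along `K ⊆ L`. -/
def repRes (K : Type*) {L : Type*} [CommRing K] [CommRing L] [Algebra K L]
    {G : Type*} [Monoid G] {U : Type*} [AddCommGroup U] [Module K U] [Module L U]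
    [IsScalarTower K L U] (ρ : Representation L G U) : Representation K G U where
  toFun g := (ρ g).restrictScalars K
  map_one' := by ext u; simp
  map_mul' g h := by ext u; simp

/-- Two representations of `G` over `k` are isomorphic iff the corresponding modules over the
group algebra `MonoidAlgebra k G` are linearly equivalent. -/
def RepIso {k : Type*} [CommSemiring k] {G : Type*} [Monoid G]
    {V W : Type*} [AddCommMonoid V] [Module k V] [AddCommMonoid W] [Module k W]
    (ρ : Representation k G V) (τ : Representation k G W) : Prop :=
  Nonempty (ρ.asModule ≃ₗ[MonoidAlgebra k G] τ.asModule)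

/-- `ρ | τ` : `ρ` is (isomorphic to) a direct summand of `τ`, i.e. `τ` is the internal direct
sum of two submodules (over the group algebra `MonoidAlgebra k G`), the first of which is
isomorphic to `ρ`. -/
def RepSummand {k : Type*} [CommSemiring k] {G : Type*} [Monoid G]
    {V W : Type*} [AddCommMonoid V] [Module k V] [AddCommMonoid W] [Module k W]
    (ρ : Representation k G V) (τ : Representation k G W) : Prop :=
  ∃ A B : Submodule (MonoidAlgebra k G) τ.asModule,
    IsCompl A B ∧ Nonempty (ρ.asModule ≃ₗ[MonoidAlgebra k G] A)

/-- A representation is indecomposable if it is nonzero and the corresponding module over the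
group algebra is not the internal direct sum of two nonzero submodules. -/
def RepIndecomposable {k : Type*} [CommSemiring k] {G : Type*} [Monoid G]
    {V : Type*} [AddCommMonoid V] [Module k V] (ρ : Representation k G V) : Prop :=
  Nontrivial V ∧
    ∀ A B : Submodule (MonoidAlgebra k G) ρ.asModule, IsCompl A B → A = ⊥ ∨ B = ⊥

/-- A representation is simple if the corresponding module over the group algebra is simple. -/
def RepSimple {k : Type*} [CommRing k] {G : Type*} [Monoid G]
    {V : Type*} [AddCommGroup V] [Module k V] (ρ : Representation k G V) : Prop :=
  IsSimpleModule (MonoidAlgebra k G) ρ.asModule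

/-- A finite division algebra over `F` is isomorphic to a subfield of the algebraic closure. -/
lemma exists_intermediateField_algEquiv (F A : Type*) [Field F] [DivisionRing A] [Algebra F A]
    [Finite A] :
    ∃ K : IntermediateField F (AlgebraicClosure F), Nonempty (K ≃ₐ[F] A) := by
  let : Field A := littleWedderburn A
  have : Module.Finite F A := Module.Finite.of_finite
  let σ : A →ₐ[F] AlgebraicClosure F := IsAlgClosed.lift
  exact ⟨σ.fieldRange, ⟨(AlgEquiv.ofInjectiveField σ).symm⟩⟩

section

variable {k G V U : Type*} [Field k] [Monoid G] [AddCommGroup V] [Module k V]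
  [AddCommGroup U] [Module k U]

/-- A representation with an equivariant split embedding into another is a direct summand. -/
lemma repSummand_of_leftInverse {ρ : Representation k G V} {τ : Representation k G U}
    (i : ρ.IntertwiningMap τ) (s : τ.IntertwiningMap ρ) (h : ∀ v, s (i v) = v) :
    RepSummand ρ τ := by
  let i' := Representation.IntertwiningMap.equivLinearMapAsModule ρ τ i
  let s' := Representation.IntertwiningMap.equivLinearMapAsModule τ ρ s
  have hsi : ∀ v, s' (i' v) = v := h
  have hinj : Function.Injective i' := Function.LeftInverse.injective hsi
  have hs : LinearMap.ker (i' ∘ₗ s') = LinearMap.ker s' :=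
    LinearMap.ker_comp_of_ker_eq_bot s' (LinearMap.ker_eq_bot.mpr hinj)
  have hi : LinearMap.range (i' ∘ₗ s') = LinearMap.range i' :=
    LinearMap.range_comp_of_range_eq_top i'
      (LinearMap.range_eq_top.mpr (Function.RightInverse.surjective hsi))
  have hidem : IsIdempotentElem (i' ∘ₗ s') :=
    LinearMap.ext fun u ↦ congrArg i' (hsi (s' u))
  refine ⟨LinearMap.range i', LinearMap.ker s', ?_, ⟨LinearEquiv.ofInjective i' hinj⟩⟩
  rw [← hs, ← hi]
  exact LinearMap.IsIdempotentElem.isCompl hidem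

/-- A representation whose operators span all endomorphisms is simple. -/
lemma repSimple_of_span_eq_top [Nontrivial V] {ρ : Representation k G V}
    (h : Submodule.span k (Set.range ρ) = ⊤) : RepSimple ρ := by
  have hsurj : Function.Surjective ρ.asAlgebraHom := by
    intro f
    have hf : f ∈ Submodule.span k (Set.range ρ) := h ▸ Submodule.mem_top
    have hle : Submodule.span k (Set.range ρ) ≤ LinearMap.range ρ.asAlgebraHom.toLinearMap := by
      rw [Submodule.span_le]
      rintro _ ⟨g, rfl⟩
      exact ⟨MonoidAlgebra.of k G g, ρ.asAlgebraHom_of g⟩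
    exact hle hf
  have htrans (x : V) (hx : x ≠ 0) (w : V) : ∃ f : Module.End k V, f x = w :=
    IsSimpleModule.toSpanSingleton_surjective (Module.End k V) hx w
  refine isSimpleModule_iff_toSpanSingleton_surjective.mpr ⟨‹Nontrivial V›, fun x hx w ↦ ?_⟩
  obtain ⟨f, hf⟩ := htrans x hx w
  obtain ⟨r, rfl⟩ := hsurj f
  exact ⟨r, hf⟩

/-- If the operators of a representation span all endomorphisms, so do those of its base change. -/
lemma span_range_repBaseChange [Module.Finite k V] (L : Type*) [Field L] [Algebra k L]
    {ρ : Representation k G V} (h : Submodule.span k (Set.range ρ) = ⊤) :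
    Submodule.span L (Set.range (repBaseChange L ρ)) = ⊤ := by
  have key (f : Module.End k V) :
      f.baseChange L ∈ Submodule.span L (Set.range (repBaseChange L ρ)) := by
    have hf : f ∈ Submodule.span k (Set.range ρ) := h ▸ Submodule.mem_top
    induction hf using Submodule.span_induction with
    | mem x hx =>
      obtain ⟨g, rfl⟩ := hx
      exact Submodule.subset_span ⟨g, rfl⟩
    | zero => simp
    | add x y _ _ hx hy =>
      rw [LinearMap.baseChange_add]
      exact add_mem hx hy
    | smul a x _ hx =>
      rw [LinearMap.baseChange_smul]
      exact Submodule.smul_of_tower_mem _ a hx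
  have hb := TensorProduct.isBaseChange k V L
  refine Submodule.eq_top_iff'.mpr fun f ↦ ?_
  induction f using (hb.linearMapLeftRight hb).inductionOn with
  | zero => exact zero_mem _
  | tmul f =>
    convert key f using 1
    ext v
    exact hb.linearMapLeftRightHom_comp_apply _ f v
  | smul a f hf => exact Submodule.smul_mem _ a hf
  | add f g hf hg => exact add_mem hf hg

end

@[simp]
lemma repBaseChange_apply_tmul {k L G V : Type*} [CommRing k] [CommRing L] [Algebra k L]
    [Monoid G] [AddCommGroup V] [Module k V] (ρ : Representation k G V) (g : G) (a : L) (v : V) :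
    repBaseChange L ρ g (a ⊗ₜ[k] v) = a ⊗ₜ[k] ρ g v :=
  rfl

@[simp]
lemma repRes_apply {K L G U : Type*} [CommRing K] [CommRing L] [Algebra K L]
    [Monoid G] [AddCommGroup U] [Module K U] [Module L U] [IsScalarTower K L U]
    (ρ : Representation L G U) (g : G) (u : U) : repRes K ρ g u = ρ g u :=
  rfl

section

variable {F K G V : Type*} [Field F] [Field K] [Algebra F K] [Monoid G] [AddCommGroup V]
  [Module F V] [Module K V] [IsScalarTower F K V]

/-- If the restriction of `ρ` to `F` is simple with only the scalars of `K` as endomorphisms,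
then the operators of `ρ` span all `K`-endomorphisms. -/
lemma span_range_eq_top_of_simple_repRes [Module.Finite K V] {ρ : Representation K G V}
    (hρ : RepSimple (repRes F ρ))
    (hend : ∀ f : Module.End (MonoidAlgebra F G) (repRes F ρ).asModule,
      ∃ c : K, ∀ v : V, f v = c • v) :
    Submodule.span K (Set.range ρ) = ⊤ := by
  have : IsSimpleModule (MonoidAlgebra F G) (repRes F ρ).asModule := hρ
  have hr (r : MonoidAlgebra F G) : ∃ h ∈ Submodule.span K (Set.range ρ),
      ∀ v, (repRes F ρ).asAlgebraHom r v = h v := by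
    induction r using MonoidAlgebra.induction_linear with
    | zero => exact ⟨0, zero_mem _, by simp⟩
    | add x y hx hy =>
      obtain ⟨a, ha, hax⟩ := hx
      obtain ⟨b, hb, hby⟩ := hy
      exact ⟨a + b, add_mem ha hb, by simp [hax, hby]⟩
    | single g a =>
      refine ⟨algebraMap F K a • ρ g,
        Submodule.smul_mem _ _ (Submodule.subset_span ⟨g, rfl⟩), fun v ↦ ?_⟩
      simp
  refine eq_top_iff.mpr fun f _ ↦ ?_
  let f' : Module.End (Module.End (MonoidAlgebra F G) (repRes F ρ).asModule)
      (repRes F ρ).asModule :=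
    { toFun := f
      map_add' := f.map_add
      map_smul' := fun e v ↦ by
        obtain ⟨c, hc⟩ := hend e
        change f (e v) = e (f v)
        exact (congrArg f (hc v)).trans ((f.map_smul c v).trans (hc (f v)).symm) }
  obtain ⟨s, hs⟩ := Module.Finite.fg_top (R := K) (M := V)
  obtain ⟨r, hrs⟩ := jacobson_density f' s
  obtain ⟨h, hh, hrh⟩ := hr r
  convert hh
  refine LinearMap.ext_on hs fun v hv ↦ ?_
  exact (hrs v hv).trans (hrh v)

/-- For a separable extension `K / F`, a representation over `K` is a direct summand of the base
change of its restriction to `F`. -/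
lemma repSummand_repBaseChange_repRes [Algebra.EssFiniteType F K]
    [Algebra.FormallyUnramified F K] (ρ : Representation K G V) :
    RepSummand ρ (repBaseChange K (repRes F ρ)) := by
  let m : K ⊗[F] V →ₗ[K] V := TensorProduct.AlgebraTensorModule.lift
      ((Algebra.lsmul K K V).toLinearMap.flip.restrictScalars F).flip
  refine repSummand_of_leftInverse
    ⟨Algebra.FormallyUnramified.sec F K V, fun g ↦ ?_⟩ ⟨m, fun g ↦ ?_⟩ fun v ↦ ?_
  · ext v
    simp only [Algebra.FormallyUnramified.sec, LinearMap.comp_apply,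
      LinearMap.coe_mk]
    induction Algebra.FormallyUnramified.elem F K using TensorProduct.induction_on with
    | zero => simp
    | tmul a b => simp
    | add x y hx hy => simp_all
  · ext v
    simp [m]
  · exact LinearMap.congr_fun (Algebra.FormallyUnramified.comp_sec F K V) v

end

/-- A simple representation over a finite field `F` is, over some finite subfield `K` of the
algebraic closure, the restriction of a `K`-representation with `K`-scalar endomorphisms. -/
lemma exists_repRes_eq {F G W : Type*} [Field F] [Monoid G] [AddCommGroup W]
    [Module F W] [Finite W] (ρ : Representation F G W) (hρ : RepSimple ρ) :
    ∃ K : IntermediateField F (AlgebraicClosure F), Finite K ∧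
      ∃ (_ : Module K W) (_ : IsScalarTower F K W) (τ : Representation K G W),
        repRes F τ = ρ ∧ ∀ f : Module.End (MonoidAlgebra F G) ρ.asModule,
          ∃ c : K, ∀ v : W, f v = c • v := by
  classical
  have : IsSimpleModule (MonoidAlgebra F G) ρ.asModule := hρ
  have : Finite ρ.asModule := ‹Finite W›
  have : Finite (Module.End (MonoidAlgebra F G) ρ.asModule) :=
    Finite.of_injective _ DFunLike.coe_injective
  obtain ⟨K, ⟨e⟩⟩ :=
    exists_intermediateField_algEquiv F (Module.End (MonoidAlgebra F G) ρ.asModule)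
  let : Module K W := Module.compHom ρ.asModule e.toRingEquiv.toRingHom
  have hsmul (c : K) (v : W) : c • v = e c v := rfl
  have htower : IsScalarTower F K W := ⟨fun a c v ↦ by
    rw [hsmul, map_smul]
    rfl⟩
  refine ⟨K, Finite.of_equiv _ e.symm.toEquiv, ‹_›, htower,
    { toFun := fun g ↦
        { toFun := ρ g
          map_add' := (ρ g).map_add
          map_smul' := fun c v ↦ ?_ }
      map_one' := by ext; simp
      map_mul' := fun g h ↦ by ext; simp }, rfl, fun f ↦ ⟨e.symm f, fun v ↦ ?_⟩⟩
  · exact (Representation.IntertwiningMap.isIntertwining ρ ρ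
      ((Representation.IntertwiningMap.equivLinearMapAsModule ρ ρ).symm (e c)) g v).symm
  · rw [hsmul, e.apply_symm_apply]

/-- Nonemptiness of the fibers of `Σ : ITS(F̄G) → ITS(FG)` : for every simple `FG`-module `W`
there are a finite subfield `K` of `F̄`, a simple `KG`-module `V` with `V | W ⊗_F K`, and a
finite-dimensional simple `F̄G`-module `X` with `V ⊗_K F̄ ≅ X`.  (From this the formula
`|ITS(F̄G)| = Σ_{W ∈ ITS(FG)} |Σ⁻¹(W)|` follows.) -/
theorem sigma_fiber_nonempty (p : ℕ) [Fact p.Prime]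
    (G : Type) [Group G] [Finite G]
    (W : FDRep (ZMod p) G) (hW : RepSimple W.ρ) :
    ∃ K : IntermediateField (ZMod p) (AlgebraicClosure (ZMod p)), Finite ↥K ∧
      ∃ V : FDRep ↥K G, RepSimple V.ρ ∧
        RepSummand V.ρ (repBaseChange ↥K W.ρ) ∧
        ∃ X : FDRep (AlgebraicClosure (ZMod p)) G, RepSimple X.ρ ∧
          RepIso (repBaseChange (AlgebraicClosure (ZMod p)) V.ρ) X.ρ := by
  have : Finite W := Module.finite_of_finite (ZMod p)
  obtain ⟨K, hK, _, _, τ, hτ, hend⟩ := exists_repRes_eq W.ρ hW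
  have : Module.Finite K W := Module.Finite.of_finite
  have : Nontrivial W := hW.nontrivial
  rw [← hτ] at hW hend ⊢
  have hspan := span_range_eq_top_of_simple_repRes hW hend
  have : Algebra.FormallyUnramified (ZMod p) K :=
    Algebra.FormallyUnramified.of_isSeparable (ZMod p) K
  exact ⟨K, hK, FDRep.of τ, repSimple_of_span_eq_top hspan, repSummand_repBaseChange_repRes τ,
    FDRep.of (repBaseChange (AlgebraicClosure (ZMod p)) τ),
    repSimple_of_span_eq_top (span_range_repBaseChange _ hspan), ⟨LinearEquiv.refl _ _⟩⟩
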